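/- arXiv:2602.01878 — 13 statements merged into one kernel-verified Lean document; each statement's English description precedes it below -/
import Mathlib

section
/- Let d be a basic nonnegative quasi-metric on a finite nonempty set I which is Gorenstein with Nakayama bijection ν. Then the poset 𝕍_d is either empty or has a minimum element, i.e. there exists m ∈ 𝕍_d with m ≤ x (componentwise) for every x ∈ 𝕍_d. -/
/-- A quasi-metric on `I`: `d i i = 0` and the triangle inequality. -/
def IsQM {I : Type*} (d : I → I → ℤ) : Prop :=
  (∀ i, d i i = 0) ∧ ∀ i j k, d i j ≤ d i k + d k j

/-- Nonnegativity: the tiled order is ℕ-graded. -/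
def IsNonnegQM {I : Type*} (d : I → I → ℤ) : Prop := ∀ i j, 0 ≤ d i j

/-- Basicness: `d i j + d j i > 0` for `i ≠ j`. -/
def IsBasicQM {I : Type*} (d : I → I → ℤ) : Prop := ∀ i j, i ≠ j → 0 < d i j + d j i

/-- Gorenstein with Nakayama bijection `ν`. -/
def IsGorQM {I : Type*} (d : I → I → ℤ) (ν : I → I) : Prop :=
  Function.Bijective ν ∧ ∀ i j, d (ν i) j + d j i = d (ν i) i

/-- The vector `v_d(i,j) ∈ ℕ^I` with `k`-th entry `max (d i k - j) 0`. -/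
def vd {I : Type*} (d : I → I → ℤ) (i : I) (j : ℕ) : I → ℕ := fun k => (d i k - j).toNat

/-- The poset `𝕍_d ⊆ ℕ^I`: all `v_d(i,j)` with `j ≥ 1`, excluding all `v_d(i,0)`. -/
def Vd {I : Type*} (d : I → I → ℤ) : Set (I → ℕ) :=
  {x | (∃ i, ∃ j : ℕ, 1 ≤ j ∧ x = vd d i j) ∧ ∀ i, x ≠ vd d i 0}

/-- If `p` has zero row and the `b`-invariants of `p, ν p, …, ν^(n-1) p` are all `1`, then the row
of `ν^n p` is the indicator function of `{p, ν p, …, ν^(n-1) p}`. -/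
theorem IsGorQM.iterate_row {I : Type*} {d : I → I → ℤ} {ν : I → I} (hqm : IsQM d)
    (hnn : IsNonnegQM d) (hbasic : IsBasicQM d) (hgor : IsGorQM d ν) {p : I}
    (hp : ∀ k, d p k = 0) (n : ℕ) (hb : ∀ m < n, d (ν (ν^[m] p)) (ν^[m] p) = 1) :
    (∀ m < n, d (ν^[n] p) (ν^[m] p) = 1) ∧
      ∀ k, (∀ m < n, ν^[m] p ≠ k) → d (ν^[n] p) k = 0 := by
  induction n using Nat.strong_induction_on with
  | _ n ih =>
    cases n with
    | zero => exact ⟨fun m hm => absurd hm (Nat.not_lt_zero m), fun k _ => hp k⟩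
    | succ n =>
      have hrow : ∀ m ≤ n, (∀ l < m, d (ν^[m] p) (ν^[l] p) = 1) ∧
          ∀ k, (∀ l < m, ν^[l] p ≠ k) → d (ν^[m] p) k = 0 := fun m hm =>
        ih m (by omega) fun l hl => hb l (by omega)
      have hbn := hb n (by omega)
      rw [Function.iterate_succ_apply']
      have hne : ∀ m < n, ν^[m] p ≠ ν^[n] p := fun m hm h => by
        have h1 := (hrow n le_rfl).1 m hm
        rw [h, hqm.1] at h1
        omega
      refine ⟨fun m hm => ?_, fun k hk => ?_⟩
      · have h0 : d (ν^[m] p) (ν^[n] p) = 0 :=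
          (hrow m (by omega)).2 _ fun l hl => hne l (by omega)
        have := hgor.2 (ν^[n] p) (ν^[m] p)
        omega
      · have h0 := (hrow n le_rfl).2 k fun l hl => hk l (by omega)
        have h1 := hbasic _ _ (hk n (by omega))
        have h2 := hgor.2 (ν^[n] p) k
        have h3 := hnn (ν (ν^[n] p)) k
        omega

/-- Along the `ν`-orbit of an element with zero row, some `b`-invariant differs from `1`. -/
theorem IsGorQM.exists_iterate_ne_one {I : Type*} [Finite I] {d : I → I → ℤ} {ν : I → I}
    (hqm : IsQM d) (hnn : IsNonnegQM d) (hbasic : IsBasicQM d) (hgor : IsGorQM d ν) {p : I}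
    (hp : ∀ k, d p k = 0) : ∃ n, d (ν (ν^[n] p)) (ν^[n] p) ≠ 1 := by
  by_contra! hb
  refine not_injective_infinite_finite (fun n => ν^[n] p)
    (Function.Injective.of_lt_imp_ne fun m n hmn h => ?_)
  have h1 := (hgor.iterate_row hqm hnn hbasic hp n fun l _ => hb l).1 m hmn
  rw [h, hqm.1] at h1
  omega

/-- If no row of `d` is zero, then `0` lies in `𝕍_d`. -/
theorem zero_mem_Vd {I : Type*} [Finite I] [Nonempty I] {d : I → I → ℤ} (hnn : IsNonnegQM d)
    (hrow : ¬ ∃ p, ∀ k, d p k = 0) : (0 : I → ℕ) ∈ Vd d := by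
  obtain ⟨i⟩ := ‹Nonempty I›
  obtain ⟨M, hM⟩ := (Set.finite_range (d i)).bddAbove
  refine ⟨⟨i, M.toNat + 1, by omega, funext fun k => ?_⟩, fun p h => hrow ⟨p, fun k => ?_⟩⟩
  · have := hM ⟨k, rfl⟩
    simp only [vd, Pi.zero_apply]
    omega
  · have h1 := congrFun h k
    have := hnn p k
    simp only [vd, Pi.zero_apply] at h1
    omega

/-- If some row of `d` is zero, then every element of `𝕍_d` is `v_d(ν i, j)` for some `i`
and some `1 ≤ j < b_i`. -/
theorem IsGorQM.exists_of_mem_Vd {I : Type*} {d : I → I → ℤ} {ν : I → I} (hnn : IsNonnegQM d)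
    (hgor : IsGorQM d ν) {p : I} (hp : ∀ k, d p k = 0) {x : I → ℕ} (hx : x ∈ Vd d) :
    ∃ i, ∃ j : ℕ, 1 ≤ j ∧ (j : ℤ) < d (ν i) i ∧ x = vd d (ν i) j := by
  obtain ⟨⟨i', j, hj, rfl⟩, hx⟩ := hx
  obtain ⟨i, rfl⟩ := hgor.1.2 i'
  refine ⟨i, j, hj, ?_, rfl⟩
  by_contra! h
  refine hx p (funext fun k => ?_)
  have := hgor.2 i k
  have := hnn k i
  have := hp k
  simp only [vd]
  omega

/-- for a basic nonnegative Gorenstein quasi-metric on a finite nonempty set,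
the poset `𝕍_d` is either empty or has a minimum element. -/
theorem stmt0 {I : Type*} [Fintype I] [Nonempty I] (d : I → I → ℤ) (ν : I → I)
    (hqm : IsQM d) (hnn : IsNonnegQM d) (hbasic : IsBasicQM d) (hgor : IsGorQM d ν) :
    Vd d = ∅ ∨ ∃ m ∈ Vd d, ∀ x ∈ Vd d, m ≤ x := by
  by_cases hrow : ∃ p, ∀ k, d p k = 0
  swap
  · exact Or.inr ⟨0, zero_mem_Vd hnn hrow, fun x _ k => Nat.zero_le (x k)⟩
  obtain ⟨p, hp⟩ := hrow
  classical
  have hex := hgor.exists_iterate_ne_one hqm hnn hbasic hp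
  obtain ⟨n, hn, hmin⟩ : ∃ n, d (ν (ν^[n] p)) (ν^[n] p) ≠ 1 ∧
      ∀ m < n, d (ν (ν^[m] p)) (ν^[m] p) = 1 :=
    ⟨Nat.find hex, Nat.find_spec hex, fun m hm => not_not.1 (Nat.find_min hex hm)⟩
  have key : ∀ m ≤ n, _ := fun m hm =>
    hgor.iterate_row hqm hnn hbasic hp m fun l hl => hmin l (by omega)
  have hne : ∀ m < n, ν^[m] p ≠ ν^[n] p := fun m hm h => hn (h ▸ hmin m hm)
  have hzero : ∀ i, d (ν i) i ≠ 1 → d (ν^[n] p) i = 0 := fun i hi =>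
    (key n le_rfl).2 i fun m hm h => hi (h ▸ hmin m hm)
  have heq : ∀ i, d (ν i) i ≠ 1 → d i (ν^[n] p) = 0 → i = ν^[n] p := fun i hi h => by
    by_contra hne'
    have := hbasic _ _ hne'
    have := hzero i hi
    omega
  have hb0 := hnn (ν (ν^[n] p)) (ν^[n] p)
  rcases hb0.eq_or_lt with hb | hb
  · refine Or.inl (Set.eq_empty_of_forall_notMem fun x hx => ?_)
    obtain ⟨i, j, hj, hji, -⟩ := hgor.exists_of_mem_Vd hnn hp hx
    have h1 := hgor.2 (ν^[n] p) i
    have h2 := hnn (ν (ν^[n] p)) i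
    have h3 := hnn i (ν^[n] p)
    have h4 := heq i (by omega) (by omega)
    rw [h4] at hji
    omega
  · refine Or.inr ⟨vd d (ν (ν^[n] p)) (d (ν (ν^[n] p)) (ν^[n] p) - 1).toNat,
      ⟨⟨_, _, by omega, rfl⟩, fun i' h => ?_⟩, fun x hx k => ?_⟩
    · obtain ⟨i, rfl⟩ := hgor.1.2 i'
      have h1 := congrFun h i
      have h2 := congrFun h (ν^[n] p)
      have h3 := hgor.2 (ν^[n] p) i
      have h4 := hnn i (ν^[n] p)
      have h5 := hgor.2 i (ν^[n] p)
      have h6 := hnn (ν^[n] p) i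
      have h7 := hnn (ν i) i
      simp only [vd] at h1 h2
      by_cases hi : d (ν i) i = 1
      · by_cases hP : ∃ m < n, ν^[m] p = i
        · obtain ⟨m, hm, rfl⟩ := hP
          have h8 := (key (m + 1) hm).2 (ν^[n] p) fun l hl => hne l (by omega)
          rw [Function.iterate_succ_apply'] at h8
          omega
        · push Not at hP
          have h8 := (key n le_rfl).2 i hP
          have h9 : i = ν^[n] p := by
            by_contra h'
            have := hbasic _ _ h'
            omega
          exact hn (h9 ▸ hi)
      · omega
    · obtain ⟨i, j, hj, hji, rfl⟩ := hgor.exists_of_mem_Vd hnn hp hx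
      have h1 := hgor.2 (ν^[n] p) k
      have h2 := hgor.2 i k
      have h3 := hqm.2 k i (ν^[n] p)
      have h4 := hzero i (by omega)
      have h5 := hnn k (ν^[n] p)
      simp only [vd]
      omega
end

section
/- Let d be a basic nonnegative quasi-metric on a finite nonempty set I which is Gorenstein with Nakayama bijection ν, and suppose some b-invariant is zero, i.e. d(ν i₀, i₀) = 0 for some i₀ ∈ I. Then the poset 𝕍_d is either empty, or it has both a maximum element and a minimum element (with respect to the componentwise order). -/
/-- if some b-invariant is zero, then `𝕍_d` is either empty or has
both a maximum and a minimum element. -/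
theorem stmt3 {I : Type*} [Fintype I] [Nonempty I] (d : I → I → ℤ) (ν : I → I)
    (hqm : IsQM d) (hnn : IsNonnegQM d) (hbasic : IsBasicQM d) (hgor : IsGorQM d ν)
    (i₀ : I) (hzero : d (ν i₀) i₀ = 0) :
    Vd d = ∅ ∨
      ((∃ M ∈ Vd d, ∀ x ∈ Vd d, x ≤ M) ∧ (∃ m ∈ Vd d, ∀ x ∈ Vd d, m ≤ x)) := by
  obtain ⟨h0, htri⟩ := hqm
  obtain ⟨⟨-, hsurj⟩, hg⟩ := hgor
  have hz : ∀ j, d (ν i₀) j = 0 := fun j => by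
    linarith [hg i₀ j, hnn (ν i₀) j, hnn j i₀]
  have ha : ∀ j, d j i₀ = 0 := fun j => by
    linarith [hg i₀ j, hnn (ν i₀) j, hnn j i₀]
  have hrow : ∀ i k, d i k ≤ d i₀ k := fun i k => by
    linarith [htri i k i₀, ha i]
  have hcol : ∀ i k, d i k ≤ d i (ν i₀) := fun i k => by
    linarith [htri i k (ν i₀), hz k]
  have hb : ∀ l j, d (ν l) j + d j l = d i₀ l := fun l j => by
    linarith [hg l j, hg l i₀, ha (ν l)]
  have hpos : ∀ k, k ≠ i₀ → 0 < d i₀ k := fun k hk => by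
    linarith [hbasic k i₀ hk, ha k]
  have hposz : ∀ k, k ≠ ν i₀ → 0 < d k (ν i₀) := fun k hk => by
    linarith [hbasic k (ν i₀) hk, hz k]
  -- Every element of `𝕍_d` is nonzero, hence positive at `ν i₀`.
  have hne : ∀ i (j : ℕ), vd d i j ∈ Vd d → (j : ℤ) < d i (ν i₀) := by
    intro i j hx
    by_contra! h
    refine hx.2 (ν i₀) (funext fun k => ?_)
    have h1 := hcol i k
    have h2 := hz k
    simp only [vd]
    omega
  rcases le_or_gt (d i₀ (ν i₀)) 1 with hN | hN
  · left
    ext x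
    simp only [Set.mem_empty_iff_false, iff_false]
    intro hx
    obtain ⟨i, j, hj, rfl⟩ := hx.1
    have h1 := hne i j hx
    have h2 := hrow i (ν i₀)
    omega
  right
  constructor
  · refine ⟨vd d i₀ 1, ⟨⟨i₀, 1, le_rfl, rfl⟩, fun i h => ?_⟩, ?_⟩
    · have hi : ∀ k, d i k = max (d i₀ k - 1) 0 := fun k => by
        have h1 := congrFun h k
        have h2 := hnn i k
        simp only [vd] at h1
        omega
      obtain ⟨l, rfl⟩ := hsurj i
      by_cases hl : l = i₀
      · subst hl
        have h1 := hi (ν l)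
        have h2 := hz (ν l)
        omega
      · have h1 := hi l
        have h2 := hb l (ν l)
        have h3 := hpos l hl
        have h4 := h0 (ν l)
        omega
    · intro x hx k
      obtain ⟨i, j, hj, rfl⟩ := hx.1
      have h1 := hrow i k
      simp only [vd]
      omega
  · -- The minimum is the indicator vector of `ν i₀`.
    obtain ⟨n, hn⟩ := Int.eq_ofNat_of_zero_le (hnn i₀ (ν i₀))
    have hmz : vd d (ν (ν i₀)) (n - 1) (ν i₀) = 1 := by
      have h1 := hb (ν i₀) (ν i₀)
      have h2 := h0 (ν i₀)
      simp only [vd]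
      omega
    have hmk : ∀ k, k ≠ ν i₀ → vd d (ν (ν i₀)) (n - 1) k = 0 := fun k hk => by
      have h1 := hb (ν i₀) k
      have h2 := hposz k hk
      simp only [vd]
      omega
    refine ⟨vd d (ν (ν i₀)) (n - 1), ⟨⟨_, n - 1, by omega, rfl⟩, fun i h => ?_⟩, ?_⟩
    · obtain ⟨l, rfl⟩ := hsurj i
      rw [h] at hmz hmk
      have h1 := hb l (ν i₀)
      have h2 := hz l
      by_cases hl : l = ν i₀
      · subst hl
        simp only [vd] at hmz
        omega
      · have h3 := hmk l hl
        have h4 := hb l l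
        have h5 := h0 l
        simp only [vd] at h3 hmz
        omega
    · intro x hx k
      obtain ⟨i, j, hj, rfl⟩ := hx.1
      by_cases hk : k = ν i₀
      · subst hk
        rw [hmz]
        have h1 := hne i j hx
        simp only [vd]
        omega
      · rw [hmk k hk]
        exact Nat.zero_le _
end

section
/- Let d be a basic nonnegative quasi-metric on a finite set I which is Gorenstein with Nakayama bijection ν, and suppose d(ν i, i) = 0 for some i ∈ I. Then for all j, k ∈ I one has d(i, j) = d(ν j, j) and d(i, j) ≥ d(k, j); in other words, the i-th row of the exponent matrix consists exactly of the b-invariants and dominates every other row entrywise. -/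
/-- if `d (ν i) i = 0` then the `i`-th row of the exponent matrix
consists of the b-invariants and dominates every other row entrywise. -/
theorem stmt4 {I : Type*} [Fintype I] (d : I → I → ℤ) (ν : I → I)
    (hqm : IsQM d) (hnn : IsNonnegQM d) (hbasic : IsBasicQM d) (hgor : IsGorQM d ν)
    (i : I) (hzero : d (ν i) i = 0) :
    ∀ j k : I, d i j = d (ν j) j ∧ d k j ≤ d i j := by
  obtain ⟨-, hgor⟩ := hgor
  have hcol : ∀ j, d j i = 0 := fun j => by
    linarith [hgor i j, hnn (ν i) j, hnn j i]
  intro j k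
  have hrow : d i j = d (ν j) j := by
    linarith [hgor j i, hcol (ν j)]
  exact ⟨hrow, by linarith [hgor j k, hnn (ν j) k]⟩
end

section
/- Let d be a basic nonnegative quasi-metric on a finite set I which is Gorenstein with Nakayama bijection ν, and suppose d(ν i, i) = 0 for some i ∈ I. Then d(ν² i, ν i) ≥ d(ν j, j) for every j ∈ I; that is, d(ν² i, ν i) is the greatest b-invariant of d. -/
/-- if `d (ν i) i = 0` then `d (ν (ν i)) (ν i)` is the greatest
b-invariant of `d`. -/
theorem stmt5 {I : Type*} [Fintype I] (d : I → I → ℤ) (ν : I → I)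
    (hqm : IsQM d) (hnn : IsNonnegQM d) (hbasic : IsBasicQM d) (hgor : IsGorQM d ν)
    (i : I) (hzero : d (ν i) i = 0) :
    ∀ j : I, d (ν j) j ≤ d (ν (ν i)) (ν i) := by
  intro j
  -- The row of `ν i` vanishes, so `d (ν j) j ≤ d (ν j) (ν i)`.
  have hrow : d (ν i) j = 0 := by
    linarith [hgor.2 i j, hnn (ν i) j, hnn j i]
  linarith [hqm.2 (ν j) j (ν i), hgor.2 (ν i) (ν j), hnn (ν (ν i)) (ν j)]
end

section
/- Let Q be a finite poset and define δ : Q × Q → ℤ by δ(i,j) = 0 if i ≤ j in Q and δ(i,j) = 1 otherwise. On the set I = Q × {1,2} define D by D((i,1),(j,1)) = D((i,2),(j,2)) = δ(i,j), D((i,1),(j,2)) = 1 − δ(j,i), and D((i,2),(j,1)) = 2 − δ(j,i). Then D is a nonnegative basic quasi-metric on I, and D is Gorenstein with Nakayama bijection ν given by ν(i,1) = (i,2) and ν(i,2) = (i,1); its b-invariants are D(ν(i,1),(i,1)) = 2 and D(ν(i,2),(i,2)) = 1 for every i ∈ Q (in particular all b-invariants equal 1 or 2). -/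
/-- The incidence 0/1-function `δ` of a poset `Q`. -/
def deltaQ {Q : Type*} [PartialOrder Q] [DecidableRel ((· ≤ ·) : Q → Q → Prop)]
    (i j : Q) : ℤ := if i ≤ j then 0 else 1

/-- The doubled quasi-metric `D` on `Q × Fin 2` (here `0` plays the role of the
label `1` and `1` the role of the label `2`). -/
def DQ {Q : Type*} [PartialOrder Q] [DecidableRel ((· ≤ ·) : Q → Q → Prop)]
    (p q : Q × Fin 2) : ℤ :=
  if p.2 = q.2 then deltaQ p.1 q.1
  else if p.2 = 0 then 1 - deltaQ q.1 p.1
  else 2 - deltaQ q.1 p.1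

/-- The swap `ν (i,1) = (i,2)`, `ν (i,2) = (i,1)`. -/
def nuQ {Q : Type*} (p : Q × Fin 2) : Q × Fin 2 := (p.1, 1 - p.2)

section Delta

variable {Q : Type*} [PartialOrder Q] [DecidableRel ((· ≤ ·) : Q → Q → Prop)]

theorem deltaQ_nonneg (i j : Q) : 0 ≤ deltaQ i j := by
  unfold deltaQ
  split_ifs <;> simp

theorem deltaQ_le_one (i j : Q) : deltaQ i j ≤ 1 := by
  unfold deltaQ
  split_ifs <;> simp

theorem deltaQ_self (i : Q) : deltaQ i i = 0 := by
  simp [deltaQ]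

theorem deltaQ_triangle (i j k : Q) : deltaQ i j ≤ deltaQ i k + deltaQ k j := by
  have h : i ≤ k → k ≤ j → i ≤ j := le_trans
  unfold deltaQ
  split_ifs <;> simp_all

theorem deltaQ_add_pos {i j : Q} (hij : i ≠ j) : 0 < deltaQ i j + deltaQ j i := by
  have h : i ≤ j → ¬ j ≤ i := fun h₁ h₂ => hij (le_antisymm h₁ h₂)
  unfold deltaQ
  split_ifs <;> simp_all

end Delta

section Doubling

variable {Q : Type*} [PartialOrder Q] [DecidableRel ((· ≤ ·) : Q → Q → Prop)]

theorem DQ_zero_zero (i j : Q) : DQ (i, 0) (j, 0) = deltaQ i j := by simp [DQ]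

theorem DQ_one_one (i j : Q) : DQ (i, 1) (j, 1) = deltaQ i j := by simp [DQ]

theorem DQ_zero_one (i j : Q) : DQ (i, 0) (j, 1) = 1 - deltaQ j i := by simp [DQ]

theorem DQ_one_zero (i j : Q) : DQ (i, 1) (j, 0) = 2 - deltaQ j i := by simp [DQ]

end Doubling

theorem nuQ_zero {Q : Type*} (i : Q) : nuQ (i, 0) = (i, 1) := by simp [nuQ]

theorem nuQ_one {Q : Type*} (i : Q) : nuQ (i, 1) = (i, 0) := by simp [nuQ]

theorem nuQ_involutive {Q : Type*} : Function.Involutive (nuQ (Q := Q)) := fun p => by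
  simp [nuQ]

/-- the doubling construction yields a nonnegative basic Gorenstein
quasi-metric on `Q × Fin 2` with Nakayama bijection the swap, whose b-invariants
are `2` on the first copy and `1` on the second copy. -/
theorem stmt6 {Q : Type*} [Fintype Q] [PartialOrder Q]
    [DecidableRel ((· ≤ ·) : Q → Q → Prop)] :
    IsNonnegQM (DQ (Q := Q)) ∧ IsQM (DQ (Q := Q)) ∧ IsBasicQM (DQ (Q := Q)) ∧
    IsGorQM (DQ (Q := Q)) nuQ ∧
    ∀ i : Q, DQ (nuQ ((i, 0) : Q × Fin 2)) (i, 0) = 2 ∧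
      DQ (nuQ ((i, 1) : Q × Fin 2)) (i, 1) = 1 := by
  refine ⟨?_, ⟨?_, ?_⟩, ?_, ⟨nuQ_involutive.bijective, ?_⟩, ?_⟩
  · rintro ⟨i, a⟩ ⟨j, b⟩
    have h₁ := deltaQ_nonneg i j
    have h₂ := deltaQ_le_one j i
    fin_cases a <;> fin_cases b <;>
      simp only [Fin.zero_eta, Fin.mk_one, DQ_zero_zero, DQ_one_one, DQ_zero_one, DQ_one_zero] <;>
      lia
  · rintro ⟨i, a⟩
    simp [DQ, deltaQ_self]
  · rintro ⟨i, a⟩ ⟨j, b⟩ ⟨k, c⟩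
    have h₁ := deltaQ_triangle i j k
    have h₂ := deltaQ_triangle j k i
    have h₃ := deltaQ_triangle k i j
    have h₄ := deltaQ_le_one i j
    have h₅ := deltaQ_le_one k i
    have h₆ := deltaQ_le_one j k
    fin_cases a <;> fin_cases b <;> fin_cases c <;>
      simp only [Fin.zero_eta, Fin.mk_one, DQ_zero_zero, DQ_one_one, DQ_zero_one, DQ_one_zero] <;>
      lia
  · rintro ⟨i, a⟩ ⟨j, b⟩ hne
    have h₁ := deltaQ_le_one i j
    have h₂ := deltaQ_le_one j i
    have h₃ : a = b → 0 < deltaQ i j + deltaQ j i := by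
      rintro rfl
      exact deltaQ_add_pos fun h => hne (by rw [h])
    clear hne
    fin_cases a <;> fin_cases b <;>
      simp only [Fin.zero_eta, Fin.mk_one, DQ_zero_zero, DQ_one_one, DQ_zero_one, DQ_one_zero] <;>
      first
        | exact h₃ rfl
        | lia
  · rintro ⟨i, a⟩ ⟨j, b⟩
    have h := deltaQ_self i
    fin_cases a <;> fin_cases b <;>
      simp only [Fin.zero_eta, Fin.mk_one, nuQ_zero, nuQ_one, DQ_zero_zero, DQ_one_one,
        DQ_zero_one, DQ_one_zero] <;>
      lia
  · intro i
    simp [nuQ_zero, nuQ_one, DQ_zero_one, DQ_one_zero, deltaQ_self]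
end

section
/- Let d be a quasi-metric on a finite set I and let m ≥ 1 be an integer. Define d^[m] on the set I × {0,1,…,m−1} by d^[m]((i,s),(j,t)) = ⌈(d(i,j) + s − t)/m⌉ (ceiling of the rational number (d(i,j)+s−t)/m). Then d^[m] is a quasi-metric on I × {0,1,…,m−1}; that is, d^[m]((i,s),(i,s)) = 0 and d^[m]((i,s),(k,u)) + d^[m]((k,u),(j,t)) ≥ d^[m]((i,s),(j,t)) for all arguments. (d^[m] is the exponent matrix of the m-th covering of the tiled order determined by d.) -/
/-- The exponent matrix `d^[m]` of the `m`-th covering: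
`d^[m]((i,s),(j,t)) = ⌈(d i j + s − t) / m⌉`. -/
def coverQM {I : Type*} (d : I → I → ℤ) (m : ℕ) (p q : I × Fin m) : ℤ :=
  ⌈((d p.1 q.1 + (p.2 : ℤ) - (q.2 : ℤ) : ℤ) : ℚ) / (m : ℚ)⌉

/-- the covering `d^[m]` of a quasi-metric is again a quasi-metric. -/
theorem stmt8 {I : Type*} [Fintype I] (d : I → I → ℤ) (hqm : IsQM d)
    (m : ℕ) (hm : 1 ≤ m) :
    (∀ p : I × Fin m, coverQM d m p p = 0) ∧
    ∀ p q r : I × Fin m, coverQM d m p q ≤ coverQM d m p r + coverQM d m r q := by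
  refine ⟨fun p => by simp [coverQM, hqm.1], fun p q r => ?_⟩
  unfold coverQM
  refine (Int.ceil_le_ceil ?_).trans (Int.ceil_add_le _ _)
  rw [← add_div]
  gcongr
  have := hqm.2 p.1 q.1 r.1
  exact_mod_cast (by linarith)
end

section
/- Let d be a basic quasi-metric on a finite set I which is Gorenstein with Nakayama bijection ν, and let O ⊆ I be an orbit of ν. Then the restriction of d to O × O is a basic quasi-metric on O which is Gorenstein with Nakayama bijection the restriction ν|_O, this restricted bijection acts transitively on O, and its b-invariants are d(ν i, i) for i ∈ O; in other words, the diagonal block of the exponent matrix corresponding to each ν-orbit is the exponent matrix of a cyclic Gorenstein tiled order. -/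
/-- Any two points on the forward orbit of an injective self-map of a finite type are connected
by an iterate of the map. -/
theorem Function.Injective.exists_iterate_eq_of_mem_range {I : Type*} [Finite I] {ν : I → I}
    (hν : Function.Injective ν) {i₀ i j : I}
    (hi : i ∈ Set.range fun t : ℕ => ν^[t] i₀) (hj : j ∈ Set.range fun t : ℕ => ν^[t] i₀) :
    ∃ t : ℕ, ν^[t] i = j := by
  obtain ⟨a, rfl⟩ := hi
  obtain ⟨b, rfl⟩ := hj
  obtain ⟨n, hn, hper⟩ := hν.mem_periodicPts i₀
  have hle : a ≤ n * a := Nat.le_mul_of_pos_left a hn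
  refine ⟨b + (n * a - a), ?_⟩
  dsimp only
  rw [← Function.iterate_add_apply, Nat.add_assoc, Nat.sub_add_cancel hle,
    Function.iterate_add_apply, (hper.mul_const a).eq]

/-- the restriction of a basic Gorenstein quasi-metric to a ν-orbit
is a basic Gorenstein quasi-metric whose Nakayama bijection acts transitively
(a cyclic Gorenstein tiled order). -/
theorem stmt12 {I : Type*} [Fintype I] (d : I → I → ℤ) (ν : I → I)
    (hqm : IsQM d) (hbasic : IsBasicQM d) (hgor : IsGorQM d ν)
    (O : Set I) (i₀ : I) (hO : O = Set.range fun t : ℕ => ν^[t] i₀) :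
    (∀ i ∈ O, d i i = 0) ∧
    (∀ i ∈ O, ∀ j ∈ O, ∀ k ∈ O, d i j ≤ d i k + d k j) ∧
    (∀ i ∈ O, ∀ j ∈ O, i ≠ j → 0 < d i j + d j i) ∧
    Set.BijOn ν O O ∧
    (∀ i ∈ O, ∀ j ∈ O, d (ν i) j + d j i = d (ν i) i) ∧
    (∀ i ∈ O, ∀ j ∈ O, ∃ t : ℕ, ν^[t] i = j) := by
  subst hO
  obtain ⟨hν, hd⟩ := hgor
  have htrans : ∀ i ∈ Set.range (fun t : ℕ => ν^[t] i₀),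
      ∀ j ∈ Set.range (fun t : ℕ => ν^[t] i₀), ∃ t : ℕ, ν^[t] i = j :=
    fun _ hi _ hj => hν.injective.exists_iterate_eq_of_mem_range hi hj
  have hmaps : Set.MapsTo ν (Set.range fun t : ℕ => ν^[t] i₀)
      (Set.range fun t : ℕ => ν^[t] i₀) := by
    rintro _ ⟨t, rfl⟩
    exact ⟨t + 1, Function.iterate_succ_apply' ν t i₀⟩
  refine ⟨fun i _ => hqm.1 i, fun i _ j _ k _ => hqm.2 i j k, fun i _ j _ => hbasic i j,
    ⟨hmaps, hν.injective.injOn, fun j hj => ?_⟩, fun i _ j _ => hd i j, htrans⟩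
  obtain ⟨t, ht⟩ := htrans (ν j) (hmaps hj) j hj
  exact ⟨ν^[t] j, hmaps.iterate t hj, by
    rw [← Function.iterate_succ_apply' ν t j, Function.iterate_succ_apply, ht]⟩
end

section
/- Let d be a basic nonnegative quasi-metric on a finite set I with |I| = n ≥ 1, which is Gorenstein with Nakayama bijection ν acting transitively on I, and suppose all b-invariants equal 1, i.e. d(ν i, i) = 1 for every i ∈ I. Then n = 2, and consequently d(i,j) = 1 for all i ≠ j. -/
/-- The Nakayama bijection of a Gorenstein quasi-metric with constant b-invariant is an isometry. -/
theorem IsGorQM.isometry_of_const {I : Type*} {d : I → I → ℤ} {ν : I → I} {b : ℤ}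
    (hgor : IsGorQM d ν) (hb : ∀ i, d (ν i) i = b) (i j : I) : d (ν i) (ν j) = d i j := by
  have h₁ := hgor.2 i (ν j)
  have h₂ := hgor.2 j i
  rw [hb] at h₁ h₂
  omega

/-- An isometry of a finite nonnegative basic quasi-metric moves no point to a different point
at distance zero. -/
theorem IsQM.eq_of_isometry_of_dist_eq_zero {I : Type*} [Finite I] {d : I → I → ℤ}
    (hqm : IsQM d) (hnn : IsNonnegQM d) (hbasic : IsBasicQM d) {f : I → I}
    (hinj : Function.Injective f) (hiso : ∀ i j, d (f i) (f j) = d i j) {i : I}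
    (hi : d i (f i) = 0) : i = f i := by
  have hiter : ∀ k : ℕ, d i (f^[k] i) = 0 := by
    intro k
    induction k with
    | zero => exact hqm.1 i
    | succ k ih =>
      have h₁ := hqm.2 i (f^[k + 1] i) (f i)
      have h₂ := hnn i (f^[k + 1] i)
      rw [Function.iterate_succ_apply'] at h₁ h₂ ⊢
      rw [hiso] at h₁
      omega
  obtain ⟨k, hk, hper⟩ := hinj.mem_periodicPts i
  obtain ⟨m, rfl⟩ := Nat.exists_eq_succ_of_ne_zero (Nat.pos_iff_ne_zero.mp hk)
  have hback : d (f i) i = 0 := by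
    have h := hiso i (f^[m] i)
    rw [← Function.iterate_succ_apply' f, hper.eq, hiter] at h
    exact h
  by_contra hne
  have := hbasic i (f i) hne
  omega

/-- a basic nonnegative Gorenstein quasi-metric with transitive
Nakayama bijection whose b-invariants all equal `1` has exactly two points, and
`d i j = 1` for `i ≠ j`. -/
theorem stmt13 {I : Type*} [Fintype I] (d : I → I → ℤ) (ν : I → I) (n : ℕ)
    (hn : 1 ≤ n) (hcard : Fintype.card I = n)
    (hqm : IsQM d) (hnn : IsNonnegQM d) (hbasic : IsBasicQM d) (hgor : IsGorQM d ν)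
    (htrans : ∀ i j : I, ∃ t : ℕ, ν^[t] i = j)
    (hb1 : ∀ i : I, d (ν i) i = 1) :
    n = 2 ∧ ∀ i j : I, i ≠ j → d i j = 1 := by
  have hiso := hgor.isometry_of_const hb1
  have hiso_iter : ∀ (t : ℕ) (i j : I), d (ν^[t] i) (ν^[t] j) = d i j := by
    intro t
    induction t with
    | zero => exact fun _ _ => rfl
    | succ t ih => exact fun i j => (ih (ν i) (ν j)).trans (hiso i j)
  have hzero : ∀ i j : I, d i j = 0 → i = j := by
    intro i j hij
    obtain ⟨t, rfl⟩ := htrans i j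
    exact hqm.eq_of_isometry_of_dist_eq_zero hnn hbasic (hgor.1.1.iterate t) (hiso_iter t) hij
  have hone : ∀ i j : I, i ≠ j → d i j = 1 := by
    intro i j hij
    have h₁ := hgor.2 j i
    rw [hb1] at h₁
    have h₂ := hnn (ν j) i
    have h₃ := hnn i j
    have h₄ : d i j ≠ 0 := fun h => hij (hzero i j h)
    omega
  refine ⟨?_, hone⟩
  obtain ⟨i⟩ : Nonempty I := Fintype.card_pos_iff.mp (by omega)
  have hne : i ≠ ν i := by
    intro h
    have h₁ := hb1 i
    rw [← h, hqm.1] at h₁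
    omega
  rw [← hcard, ← Nat.card_eq_fintype_card, Nat.card_eq_two_iff]
  refine ⟨i, ν i, hne, Set.eq_univ_of_forall fun j => ?_⟩
  by_cases hj : j = i
  · exact Or.inl hj
  · have h₁ := hgor.2 i j
    rw [hb1, hone j i hj] at h₁
    exact Or.inr (hzero (ν i) j (by omega)).symm
end

section
/- Let d be a basic nonnegative quasi-metric on a finite set I with |I| = n ≥ 1, which is Gorenstein with Nakayama bijection ν. Then the poset 𝕍_d is empty if and only if there exists a bijection σ : {1,…,n} → I such that d(σ a, σ b) = 1 whenever a > b and d(σ a, σ b) = 0 whenever a ≤ b (i.e. the exponent matrix is, up to simultaneous permutation of rows and columns, the strictly lower triangular all-ones matrix, the hereditary case). -/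
/-- If `𝕍_d` is empty, every truncated row of `d` is again a row of `d`. -/
theorem exists_row_eq_of_Vd_eq_empty {I : Type*} {d : I → I → ℤ} (hnn : IsNonnegQM d)
    (h : Vd d = ∅) (i : I) (j : ℕ) (hj : 1 ≤ j) : ∃ m, ∀ k, d m k = max (d i k - j) 0 := by
  by_contra! hne
  have hmem : vd d i j ∈ Vd d := by
    refine ⟨⟨i, j, hj, rfl⟩, fun m hm => ?_⟩
    obtain ⟨k, hk⟩ := hne m
    have := congrFun hm k
    have := hnn m k
    simp only [vd] at *
    omega
  simp [h] at hmem

/-- If `𝕍_d` is empty, then `d` has a zero row. -/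
theorem exists_zero_row_of_Vd_eq_empty {I : Type*} [Fintype I] [Nonempty I] {d : I → I → ℤ}
    (hnn : IsNonnegQM d) (h : Vd d = ∅) : ∃ m, ∀ k, d m k = 0 := by
  obtain ⟨i⟩ := ‹Nonempty I›
  obtain ⟨m, hm⟩ := exists_row_eq_of_Vd_eq_empty hnn h i (1 + ∑ k, (d i k).toNat) (by omega)
  refine ⟨m, fun k => ?_⟩
  have hk := Finset.single_le_sum (f := fun k => (d i k).toNat) (fun _ _ => Nat.zero_le _)
    (Finset.mem_univ k)
  have := hm k
  omega

/-- If `𝕍_d` is empty, then all `b`-invariants are at most `1`. -/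
theorem b_le_one_of_Vd_eq_empty {I : Type*} {d : I → I → ℤ} {ν : I → I}
    (hnn : IsNonnegQM d) (hbasic : IsBasicQM d) (hgor : IsGorQM d ν)
    (h : Vd d = ∅) (i : I) : d (ν i) i ≤ 1 := by
  by_contra! hb
  obtain ⟨m, hm⟩ := exists_row_eq_of_Vd_eq_empty hnn h (ν i) 1 le_rfl
  obtain ⟨i', rfl⟩ := hgor.1.2 m
  have := hm i
  have := hm i'
  have := hgor.2 i i'
  have := hgor.2 i' i
  have := hnn i i'
  have := hnn i' i
  by_cases hii : i = i'
  · subst hii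
    omega
  · have := hbasic i i' hii
    omega

/-- A basic Gorenstein quasi-metric with `b`-invariants at most `1` and a zero row is total:
of `d i k` and `d k i`, at least one vanishes. -/
theorem eq_zero_or_eq_zero_of_b_le_one {I : Type*} [Fintype I] {d : I → I → ℤ} {ν : I → I}
    (hnn : IsNonnegQM d) (hbasic : IsBasicQM d) (hgor : IsGorQM d ν)
    (hb : ∀ i, d (ν i) i ≤ 1) {m : I} (hm : ∀ k, d m k = 0) (i k : I) :
    d i k = 0 ∨ d k i = 0 := by
  obtain ⟨t, rfl⟩ := hgor.1.2 m
  have ht : ∀ j, d j t = 0 := fun j => by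
    have := hgor.2 t j
    have := hm j
    have := hm t
    omega
  have hν : ∀ i j, d (ν j) (ν i) ≤ d j i ∨ d (ν i) i = 0 := fun i j => by
    have := hgor.2 j (ν i)
    have := hgor.2 i j
    have := hb i
    have := hb j
    have := hnn (ν i) i
    have := hnn (ν i) j
    have := hnn j i
    omega
  -- column sums strictly decrease along `ν` away from the zero column `t`
  have hcol : ∀ i, d (ν i) i ≠ 0 → ∑ j, d j (ν i) < ∑ j, d j i := fun i hi => by
    rw [← Function.Bijective.sum_comp hgor.1 (fun j => d j (ν i))]
    refine Finset.sum_lt_sum (fun j _ => (hν i j).resolve_right hi) ⟨t, Finset.mem_univ t, ?_⟩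
    have hit : t ≠ i := by
      rintro rfl
      exact hi (hm _)
    have := hbasic t i hit
    have := ht i
    have := hm (ν i)
    omega
  induction hc : (∑ j, d j i).toNat using Nat.strong_induction_on generalizing i k with
  | _ c ih =>
    by_contra! hik
    have hgi := hgor.2 i k
    have hgk := hgor.2 k i
    have h1 := hgor.2 i (ν k)
    have h2 := hgor.2 k (ν i)
    have := hnn i k
    have := hnn k i
    have := hnn (ν i) k
    have := hnn (ν k) i
    have := hb i
    have := hb k
    have hlt := hcol i (by omega)
    have hpos : 0 ≤ ∑ j, d j (ν i) := Finset.sum_nonneg fun j _ => hnn j _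
    have := ih _ (by omega) (ν i) (ν k) rfl
    omega

/-- A total basic quasi-metric with values in `{0, 1}` is, up to a bijection, the strictly lower
triangular all-ones matrix. -/
theorem exists_equiv_of_total {I : Type*} [Fintype I] {d : I → I → ℤ} {n : ℕ}
    (hcard : Fintype.card I = n) (hqm : IsQM d) (hnn : IsNonnegQM d) (hbasic : IsBasicQM d)
    (hle : ∀ i k, d i k ≤ 1) (htot : ∀ i k, d i k = 0 ∨ d k i = 0) :
    ∃ σ : Fin n ≃ I, ∀ a b : Fin n,
      (b < a → d (σ a) (σ b) = 1) ∧ (a ≤ b → d (σ a) (σ b) = 0) := by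
  classical
  let _ : LinearOrder I :=
    { le := fun i k => d i k = 0
      le_refl := hqm.1
      le_trans := fun i j k hij hjk => by
        have := hqm.2 i k j
        have := hnn i k
        omega
      le_antisymm := fun i k hik hki => by
        by_contra hne
        have := hbasic i k hne
        omega
      le_total := htot
      toDecidableLE := Classical.decRel _ }
  have σ : Fin n ≃o I := Fintype.orderIsoFinOfCardEq I hcard
  refine ⟨σ.toEquiv, fun a b => ⟨fun hab => ?_, fun hab => σ.le_iff_le.2 hab⟩⟩
  have h0 : d (σ a) (σ b) ≠ 0 := fun h0 => absurd (σ.le_iff_le.1 h0) (not_le.2 hab)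
  have := hle (σ a) (σ b)
  have := hnn (σ a) (σ b)
  change d (σ a) (σ b) = 1
  omega

/-- `𝕍_d` is empty iff, after a bijection `σ : Fin n ≃ I`, the
exponent matrix is the strictly lower triangular all-ones matrix (the hereditary
case). -/
theorem stmt14 {I : Type*} [Fintype I] (d : I → I → ℤ) (ν : I → I) (n : ℕ)
    (hn : 1 ≤ n) (hcard : Fintype.card I = n)
    (hqm : IsQM d) (hnn : IsNonnegQM d) (hbasic : IsBasicQM d) (hgor : IsGorQM d ν) :
    Vd d = ∅ ↔ ∃ σ : Fin n ≃ I, ∀ a b : Fin n,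
      (b < a → d (σ a) (σ b) = 1) ∧ (a ≤ b → d (σ a) (σ b) = 0) := by
  constructor
  · intro h
    have : Nonempty I := Fintype.card_pos_iff.1 (by omega)
    obtain ⟨m, hm⟩ := exists_zero_row_of_Vd_eq_empty hnn h
    have hb := b_le_one_of_Vd_eq_empty hnn hbasic hgor h
    refine exists_equiv_of_total hcard hqm hnn hbasic (fun i k => ?_)
      (eq_zero_or_eq_zero_of_b_le_one hnn hbasic hgor hb hm)
    obtain ⟨i, rfl⟩ := hgor.1.2 i
    have := hgor.2 i k
    have := hnn k i
    have := hb i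
    omega
  · rintro ⟨σ, hσ⟩
    refine Set.eq_empty_iff_forall_notMem.2 ?_
    rintro _ ⟨⟨i, j, hj, rfl⟩, hne⟩
    refine hne (σ ⟨0, hn⟩) (funext fun k => ?_)
    obtain ⟨a, rfl⟩ := σ.surjective i
    obtain ⟨b, rfl⟩ := σ.surjective k
    have h0 := (hσ ⟨0, hn⟩ b).2 (Nat.zero_le _)
    have hab : d (σ a) (σ b) ≤ 1 := by
      rcases lt_or_ge b a with hlt | hge
      · exact ((hσ a b).1 hlt).le
      · exact ((hσ a b).2 hge).trans_le zero_le_one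
    simp only [vd]
    omega
end

section
/- Let d be a basic nonnegative quasi-metric on a finite set I with |I| = n ≥ 1, which is Gorenstein with Nakayama bijection ν, and suppose all b-invariants equal 1, i.e. d(ν i, i) = 1 for every i ∈ I. Then n is even and there exists a bijection σ : {1,…,n} → I such that d(σ a, σ b) = 1 if ⌈a/2⌉ > ⌈b/2⌉ or (⌈a/2⌉ = ⌈b/2⌉ and a ≠ b), and d(σ a, σ b) = 0 otherwise. -/
/-- In a basic quasi-metric, every nonempty finite set contains an element which is minimal for
the partial order `x ≤ y ↔ d x y = 0`. -/
theorem IsBasicQM.exists_minimal {I : Type*} {d : I → I → ℤ} (hqm : IsQM d)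
    (hbasic : IsBasicQM d) {S : Finset I} (hS : S.Nonempty) :
    ∃ i ∈ S, ∀ x ∈ S, d x i = 0 → x = i := by
  obtain ⟨i, hi, hmax⟩ := S.exists_max_image (fun i => ∑ y ∈ S, d y i) hS
  refine ⟨i, hi, fun x hx hxi => ?_⟩
  by_contra hne
  refine absurd (hmax x hx) (not_le.mpr ?_)
  refine Finset.sum_lt_sum (fun y _ => ?_) ⟨i, hi, ?_⟩
  · have := hqm.2 y i x
    omega
  · have := hbasic x i hne
    have := hqm.1 i
    omega

/-- If all b-invariants equal `1`, a finite set stable under the Nakayama bijection and its inverse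
has even size and can be enumerated so that `d` takes the block form with `2 × 2` antidiagonal
blocks. -/
theorem IsGorQM.exists_enumeration {I : Type*} {d : I → I → ℤ} {ν : I → I}
    (hqm : IsQM d) (hnn : IsNonnegQM d) (hbasic : IsBasicQM d) (hgor : IsGorQM d ν)
    (hb1 : ∀ i : I, d (ν i) i = 1) (S : Finset I) (hS : ∀ i, ν i ∈ S ↔ i ∈ S) :
    Even S.card ∧ ∃ g : I → ℕ, (∀ x ∈ S, g x < S.card) ∧
      ∀ x ∈ S, ∀ y ∈ S, (g x = g y → x = y) ∧
        d x y = if g y / 2 < g x / 2 ∨ (g x / 2 = g y / 2 ∧ g x ≠ g y) then 1 else 0 := by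
  classical
  induction S using Finset.strongInduction with
  | H S ih =>
    rcases S.eq_empty_or_nonempty with rfl | hne
    · exact ⟨by simp, fun _ => 0, by simp, by simp⟩
    have hdual : ∀ i j, d (ν i) j + d j i = 1 := fun i j => (hgor.2 i j).trans (hb1 i)
    have hle : ∀ i j, d i j ≤ 1 := fun i j => by
      have := hdual j i
      have := hnn (ν j) i
      omega
    obtain ⟨i, hi, hmin⟩ := hbasic.exists_minimal hqm hne
    have hiν : ν i ≠ i := fun h => by
      have := hb1 i
      have := hqm.1 i
      rw [h] at *
      omega
    have hνS : ν i ∈ S := (hS i).2 hi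
    have hone : ∀ x ∈ S, x ≠ i → d x i = 1 := fun x hx hxi => by
      have : d x i ≠ 0 := fun h => hxi (hmin x hx h)
      have := hnn x i
      have := hle x i
      omega
    have hνabove : ∀ x ∈ S, x ≠ i → d (ν i) x = 0 := fun x hx hxi => by
      have := hdual i x
      have := hone x hx hxi
      omega
    have hincomp : d i (ν i) = 1 := by
      by_contra h
      obtain ⟨k, hk⟩ := hgor.1.2 i
      have hkS : k ∈ S := (hS k).1 (hk ▸ hi)
      have h0 : d i (ν i) = 0 := by
        have := hle i (ν i)
        have := hnn i (ν i)
        omega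
      have h1 := hb1 k
      rw [hk] at h1
      by_cases hki : k = i
      · exact hiν (hki ▸ hk)
      · have := hνabove k hkS hki
        have := hqm.2 i k (ν i)
        omega
    have hνν : ν (ν i) = i := by
      apply hmin _ ((hS _).2 hνS)
      have := hdual (ν i) i
      omega
    have habove : ∀ x ∈ S, x ≠ i → x ≠ ν i → d i x = 0 ∧ d x (ν i) = 1 := fun x hx hxi hxν => by
      have h1 := hdual (ν i) x
      rw [hνν] at h1
      have := hbasic x (ν i) hxν
      have := hνabove x hx hxi
      have := hle x (ν i)
      omega
    set T := (S.erase i).erase (ν i) with hT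
    have hνmem : ν i ∈ S.erase i := Finset.mem_erase.2 ⟨hiν, hνS⟩
    have hcard : S.card = T.card + 2 := by
      have h1 := Finset.card_erase_add_one hi
      have h2 := Finset.card_erase_add_one hνmem
      rw [← hT] at h2
      omega
    have hmemT : ∀ x, x ∈ T ↔ x ≠ ν i ∧ x ≠ i ∧ x ∈ S := by simp [hT]
    have hTS : T ⊂ S := (Finset.erase_ssubset hνmem).trans (Finset.erase_ssubset hi)
    have hstable : ∀ x, ν x ∈ T ↔ x ∈ T := fun x => by
      have h1 : ν x = ν i ↔ x = i := hgor.1.1.eq_iff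
      have h2 : ν x = i ↔ x = ν i := by
        conv_lhs => rw [← hνν]
        exact hgor.1.1.eq_iff
      rw [hmemT, hmemT, hS, Ne, h1, Ne, h2]
      tauto
    obtain ⟨heven, g, hlt, hg⟩ := ih T hTS hstable
    refine ⟨by rw [hcard]; exact heven.add even_two,
      fun x => if x = i then 0 else if x = ν i then 1 else g x + 2, fun x hx => ?_,
      fun x hx y hy => ?_⟩
    · have := hlt x
      have := hmemT x
      grind
    · have hdiv : ∀ m : ℕ, (m + 2) / 2 = m / 2 + 1 := fun m => by omega
      rcases eq_or_ne x i with hxi | hxi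
      · rcases eq_or_ne y i with hyi | hyi
        · simp [hxi, hyi, hqm.1]
        rcases eq_or_ne y (ν i) with hyν | hyν
        · simp [hxi, hyν, hiν, hincomp]
        · simp [hxi, hyi, hyν, habove y hy hyi hyν, hdiv]
      rcases eq_or_ne x (ν i) with hxν | hxν
      · rcases eq_or_ne y i with hyi | hyi
        · simp [hxν, hyi, hiν, hb1]
        rcases eq_or_ne y (ν i) with hyν | hyν
        · simp [hxν, hyν, hqm.1]
        · simp [hxν, hyi, hyν, hiν, hνabove y hy hyi, hdiv]
      rcases eq_or_ne y i with hyi | hyi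
      · simp [hxi, hxν, hyi, hone x hx hxi, hdiv]
      rcases eq_or_ne y (ν i) with hyν | hyν
      · simp [hxi, hxν, hyν, hiν, habove x hx hxi hxν, hdiv]
      have hxy := hg x ((hmemT x).2 ⟨hxν, hxi, hx⟩) y ((hmemT y).2 ⟨hyν, hyi, hy⟩)
      simp only [hxi, hxν, hyi, hyν, if_false, hxy.2]
      refine ⟨fun h => hxy.1 (by omega), ?_⟩
      congr 1
      simp only [eq_iff_iff]
      omega

/-- if all b-invariants of a basic nonnegative Gorenstein
quasi-metric equal `1`, then `n` is even and, after a bijection `σ : Fin n ≃ I`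
(with `a : Fin n` playing the role of the index `a+1 ∈ {1,…,n}`, so that
`⌈(a+1)/2⌉ = (a+2)/2` in ℕ-division), the exponent matrix is the block matrix of
2×2 antidiagonal blocks below the diagonal. -/
theorem stmt15 {I : Type*} [Fintype I] (d : I → I → ℤ) (ν : I → I) (n : ℕ)
    (hn : 1 ≤ n) (hcard : Fintype.card I = n)
    (hqm : IsQM d) (hnn : IsNonnegQM d) (hbasic : IsBasicQM d) (hgor : IsGorQM d ν)
    (hb1 : ∀ i : I, d (ν i) i = 1) :
    Even n ∧ ∃ σ : Fin n ≃ I, ∀ a b : Fin n,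
      d (σ a) (σ b) =
        if (b.1 + 2) / 2 < (a.1 + 2) / 2 ∨
            ((a.1 + 2) / 2 = (b.1 + 2) / 2 ∧ a ≠ b) then 1 else 0 := by
  classical
  obtain ⟨heven, g, hlt, hg⟩ :=
    hgor.exists_enumeration hqm hnn hbasic hb1 Finset.univ (by simp)
  rw [Finset.card_univ, hcard] at heven hlt
  have hinj : Function.Injective fun x : I => (⟨g x, hlt x (Finset.mem_univ x)⟩ : Fin n) :=
    fun x y h => (hg x (Finset.mem_univ x) y (Finset.mem_univ y)).1 (Fin.mk.inj_iff.1 h)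
  let e := Equiv.ofBijective _
    ((Fintype.bijective_iff_injective_and_card _).2 ⟨hinj, by simp [hcard]⟩)
  refine ⟨heven, e.symm, fun a b => ?_⟩
  have hval : ∀ c, g (e.symm c) = c.1 := fun c => congrArg Fin.val (e.apply_symm_apply c)
  rw [(hg (e.symm a) (Finset.mem_univ _) (e.symm b) (Finset.mem_univ _)).2, hval, hval]
  congr 1
  simp only [eq_iff_iff, ne_eq, Fin.ext_iff]
  omega
end

section
/- Let d be a basic nonnegative quasi-metric on a finite set I with |I| = n ≥ 2, which is Gorenstein with Nakayama bijection ν, and suppose there is exactly one index i₀ ∈ I with d(ν i₀, i₀) = 2 while d(ν i, i) = 1 for all i ≠ i₀. Then there exists a bijection σ : {1,…,n} → I such that d(σ a, σ b) equals: 0 if a = b; 2 if (a,b) = (1,n); 1 if a < b and (a,b) ≠ (1,n); 1 if a = b + 1; and 0 if a > b + 1. -/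
/-- The Nakayama bijection changes `d` by the difference of b-invariants. -/
theorem IsGorQM.map_map {I : Type*} {d : I → I → ℤ} {ν : I → I} (h : IsGorQM d ν) (i j : I) :
    d (ν i) (ν j) = d i j + d (ν i) i - d (ν j) j := by
  linarith [h.2 i (ν j), h.2 j i]

/-- If `i₀` is the only index with b-invariant `2` and all others have b-invariant `1`, then
`ν i₀` has distance `1` to every index other than itself and `i₀`. -/
theorem IsGorQM.dist_eq_one {I : Type*} {d : I → I → ℤ} {ν : I → I} (h : IsGorQM d ν)
    (hnn : IsNonnegQM d) {i₀ : I} (hb2 : d (ν i₀) i₀ = 2)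
    (hb1 : ∀ i : I, i ≠ i₀ → d (ν i) i = 1) {x : I} (hx : x ≠ i₀) (hxf : x ≠ ν i₀) :
    d (ν i₀) x = 1 := by
  obtain ⟨y, rfl⟩ := h.1.2 x
  have hy : y ≠ i₀ := fun e => hxf (by rw [e])
  linarith [h.2 i₀ (ν y), h.2 y i₀, h.2 (ν y) (ν i₀), hb1 _ hx, hb1 _ hy, hnn i₀ y,
    hnn (ν (ν y)) (ν i₀)]

/-- Under the same hypotheses, every index lies in the `ν`-orbit of `ν i₀`. -/
theorem IsGorQM.exists_iterate_eq {I : Type*} {d : I → I → ℤ} {ν : I → I} (h : IsGorQM d ν)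
    (hnn : IsNonnegQM d) {i₀ : I} (hb2 : d (ν i₀) i₀ = 2)
    (hb1 : ∀ i : I, i ≠ i₀ → d (ν i) i = 1) {q : ℕ} (hq : ν^[q] (ν i₀) = i₀)
    (hlt : ∀ k < q, ν^[k] (ν i₀) ≠ i₀) (j : I) : ∃ k, ν^[k] (ν i₀) = j := by
  by_contra! hj
  have hout : ∀ k l, ν^[l] (ν i₀) ≠ ν^[k] j := by
    intro k
    induction k with
    | zero => exact hj
    | succ k ih =>
      intro l hl
      rw [Function.iterate_succ_apply'] at hl
      cases l with
      | zero => exact ih q (hq.trans (h.1.1 hl))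
      | succ l =>
        rw [Function.iterate_succ_apply'] at hl
        exact ih l (h.1.1 hl)
  have hne : ∀ k, ν^[k] j ≠ i₀ := fun k hk => hout k q (hq.trans hk.symm)
  have hnf : ∀ k, ν^[k] j ≠ ν i₀ := fun k hk => hout k 0 hk.symm
  have hone : ∀ k ≤ q, d (ν^[k] (ν i₀)) (ν^[k] j) = 1 := by
    intro k
    induction k with
    | zero => exact fun _ => h.dist_eq_one hnn hb2 hb1 (hne 0) (hnf 0)
    | succ k ih =>
      intro hk
      rw [Function.iterate_succ_apply', Function.iterate_succ_apply', h.map_map, ih (by omega),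
        hb1 _ (hlt k hk), hb1 _ (hne k)]
      rfl
  have h1 := hone q le_rfl
  rw [hq] at h1
  have h2 := h.map_map i₀ (ν^[q] j)
  rw [h1, hb2, hb1 _ (hne q), ← Function.iterate_succ_apply' ν,
    h.dist_eq_one hnn hb2 hb1 (hne _) (hnf _)] at h2
  norm_num at h2

/-- if exactly one b-invariant equals `2` and all the others equal
`1`, then after a bijection `σ : Fin n ≃ I` (with `a : Fin n` playing the role of
the index `a+1 ∈ {1,…,n}`) the exponent matrix is the one of the classification
for `kA₂`. -/
theorem stmt16 {I : Type*} [Fintype I] (d : I → I → ℤ) (ν : I → I) (n : ℕ)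
    (hn : 2 ≤ n) (hcard : Fintype.card I = n)
    (hqm : IsQM d) (hnn : IsNonnegQM d) (hbasic : IsBasicQM d) (hgor : IsGorQM d ν)
    (i₀ : I) (hb2 : d (ν i₀) i₀ = 2) (hb1 : ∀ i : I, i ≠ i₀ → d (ν i) i = 1) :
    ∃ σ : Fin n ≃ I, ∀ a b : Fin n,
      d (σ a) (σ b) =
        if a.1 = b.1 then 0
        else if a.1 = 0 ∧ b.1 = n - 1 then 2
        else if a.1 < b.1 then 1
        else if a.1 = b.1 + 1 then 1
        else 0 := by
  have hper : ν i₀ ∈ Function.periodicPts ν := hgor.1.1.mem_periodicPts _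
  obtain ⟨q, hqp⟩ : ∃ q, Function.minimalPeriod ν (ν i₀) = q + 1 :=
    Nat.exists_eq_succ_of_ne_zero (Function.minimalPeriod_pos_of_mem_periodicPts hper).ne'
  have hq : ν^[q] (ν i₀) = i₀ := by
    apply hgor.1.1
    rw [← Function.iterate_succ_apply' ν, Nat.succ_eq_add_one, ← hqp,
      Function.iterate_minimalPeriod]
  have hinj : ∀ a ≤ q, ∀ b ≤ q, ν^[a] (ν i₀) = ν^[b] (ν i₀) → a = b := fun a ha b hb hab =>
    Function.iterate_injOn_Iio_minimalPeriod (Set.mem_Iio.2 (by omega))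
      (Set.mem_Iio.2 (by omega)) hab
  have hlt : ∀ k < q, ν^[k] (ν i₀) ≠ i₀ := fun k hk hki =>
    hk.ne (hinj k hk.le q le_rfl (hki.trans hq.symm))
  have hbij : Function.Bijective fun a : Fin (q + 1) => ν^[a.1] (ν i₀) := by
    refine ⟨fun a b hab => Fin.ext (hinj a (by omega) b (by omega) hab), fun j => ?_⟩
    obtain ⟨k, rfl⟩ := hgor.exists_iterate_eq hnn hb2 hb1 hq hlt j
    refine ⟨⟨k % (q + 1), Nat.mod_lt _ q.succ_pos⟩, ?_⟩
    simp only [← hqp, Function.iterate_mod_minimalPeriod_eq]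
  obtain rfl : n = q + 1 := by
    rw [← hcard, ← Fintype.card_of_bijective hbij, Fintype.card_fin]
  have hshift : ∀ t k, k + t ≤ q →
      d (ν^[k] (ν i₀)) (ν^[k + t] (ν i₀)) = d (ν i₀) (ν^[t] (ν i₀)) := by
    intro t k
    induction k with
    | zero => intro _; rw [Nat.zero_add]; rfl
    | succ k ih =>
      intro hk
      rcases Nat.eq_zero_or_pos t with rfl | ht
      · simp only [Nat.add_zero, Function.iterate_zero, id, hqm.1]
      · rw [Nat.add_right_comm, Function.iterate_succ_apply', Function.iterate_succ_apply',
          hgor.map_map, ih (by omega), hb1 _ (hlt k (by omega)), hb1 _ (hlt (k + t) (by omega)),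
          add_sub_cancel_right]
  have hone : ∀ a b, a < b → b ≤ q → ¬(a = 0 ∧ b = q) →
      d (ν^[a] (ν i₀)) (ν^[b] (ν i₀)) = 1 := by
    intro a b hab hb hne
    obtain ⟨t, rfl⟩ := Nat.exists_eq_add_of_le hab.le
    rw [hshift t a hb]
    exact hgor.dist_eq_one hnn hb2 hb1 (hlt t (by omega))
      fun e => absurd (hinj t (by omega) 0 (Nat.zero_le _) e) (by omega)
  refine ⟨Equiv.ofBijective _ hbij, fun a b => ?_⟩
  obtain ⟨a, ha⟩ := a
  obtain ⟨b, hb⟩ := b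
  simp only [Equiv.ofBijective_apply, Nat.add_sub_cancel]
  split_ifs with h1 h2 h3 h4
  · rw [h1, hqm.1]
  · rw [h2.1, h2.2, hq]; exact hb2
  · exact hone a b h3 (by omega) h2
  · rw [h4, Function.iterate_succ_apply']
    exact hb1 _ (hlt b (by omega))
  · obtain ⟨c, rfl⟩ : ∃ c, a = c + 1 := ⟨a - 1, by omega⟩
    have h5 := hgor.2 (ν^[c] (ν i₀)) (ν^[b] (ν i₀))
    rw [hb1 _ (hlt c (by omega)), hone b c (by omega) (by omega) (by omega),
      ← Function.iterate_succ_apply' ν] at h5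
    linarith
end

section
/- Let d be a basic nonnegative quasi-metric on a finite set I with |I| = 3 which is Gorenstein with some Nakayama bijection ν. Then there exist a bijection σ : {1,2,3} → I and nonnegative integers a, b, c, not all zero, such that the matrix [d(σ a', σ b')]_{a',b' ∈ {1,2,3}} equals [[0, a, a+b], [b+c, 0, b], [c, c+a, 0]]; that is, every basic ℕ-graded Gorenstein tiled order of rank 3 is of the form A(a,b,c). -/
/-- In a type with three elements, three distinct elements exhaust the type. -/
theorem bijective_vec_of_card_eq_three {I : Type*} [Fintype I] (hcard : Fintype.card I = 3)
    {x y z : I} (hxy : x ≠ y) (hxz : x ≠ z) (hyz : y ≠ z) :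
    Function.Bijective ![x, y, z] := by
  refine (Fintype.bijective_iff_injective_and_card _).2 ⟨fun i j h => ?_, by simp [hcard]⟩
  fin_cases i <;> fin_cases j <;> simp_all

theorem eq_or_eq_or_eq_of_card_eq_three {I : Type*} [Fintype I] (hcard : Fintype.card I = 3)
    {x y z : I} (hxy : x ≠ y) (hxz : x ≠ z) (hyz : y ≠ z) (w : I) :
    w = x ∨ w = y ∨ w = z := by
  obtain ⟨i, rfl⟩ := (bijective_vec_of_card_eq_three hcard hxy hxz hyz).2 w
  fin_cases i <;> simp

/-- The Nakayama bijection of a basic quasi-metric on at least two points has no fixed point. -/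
theorem IsGorQM.apply_ne {I : Type*} [Nontrivial I] {d : I → I → ℤ} {ν : I → I}
    (hgor : IsGorQM d ν) (hqm : IsQM d) (hbasic : IsBasicQM d) (i : I) : ν i ≠ i := by
  intro h
  obtain ⟨j, hj⟩ := exists_ne i
  have h1 := hgor.2 i j
  rw [h, hqm.1] at h1
  exact (hbasic i j hj.symm).ne' h1

/-- A fixed-point-free injection of a type with three elements is not an involution anywhere. -/
theorem apply_apply_ne_of_card_eq_three {I : Type*} [Fintype I] (hcard : Fintype.card I = 3)
    {ν : I → I} (hinj : Function.Injective ν) (hne : ∀ i, ν i ≠ i) (i : I) : ν (ν i) ≠ i := by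
  classical
  intro h
  obtain ⟨k, -, hk⟩ := Finset.exists_mem_notMem_of_card_lt_card
    (s := {i, ν i}) (t := Finset.univ)
    (by rw [Finset.card_univ, hcard]; exact Finset.card_le_two.trans_lt (by norm_num))
  simp only [Finset.mem_insert, Finset.mem_singleton, not_or] at hk
  rcases eq_or_eq_or_eq_of_card_eq_three hcard (hne i).symm (Ne.symm hk.1) (Ne.symm hk.2) (ν k)
    with h1 | h1 | h1
  · exact hk.2 (hinj (h1.trans h.symm))
  · exact hk.1 (hinj h1)
  · exact hne k h1

/-- every basic nonnegative Gorenstein quasi-metric on a set of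
cardinality `3` has exponent matrix `[[0, a, a+b], [b+c, 0, b], [c, c+a, 0]]` for
some nonnegative integers `a, b, c`, not all zero (i.e. it is `A(a,b,c)`). -/
theorem stmt18 {I : Type*} [Fintype I] (d : I → I → ℤ)
    (hcard : Fintype.card I = 3)
    (hqm : IsQM d) (hnn : IsNonnegQM d) (hbasic : IsBasicQM d)
    (hgor : ∃ ν : I → I, IsGorQM d ν) :
    ∃ σ : Fin 3 ≃ I, ∃ a b c : ℕ, ¬ (a = 0 ∧ b = 0 ∧ c = 0) ∧
      d (σ 0) (σ 0) = 0 ∧ d (σ 0) (σ 1) = (a : ℤ) ∧ d (σ 0) (σ 2) = (a : ℤ) + b ∧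
      d (σ 1) (σ 0) = (b : ℤ) + c ∧ d (σ 1) (σ 1) = 0 ∧ d (σ 1) (σ 2) = (b : ℤ) ∧
      d (σ 2) (σ 0) = (c : ℤ) ∧ d (σ 2) (σ 1) = (c : ℤ) + a ∧ d (σ 2) (σ 2) = 0 := by
  obtain ⟨ν, hg⟩ := hgor
  have : Nontrivial I := Fintype.one_lt_card_iff_nontrivial.1 (by omega)
  have hne := hg.apply_ne hqm hbasic
  have hne2 := apply_apply_ne_of_card_eq_three hcard hg.1.1 hne
  obtain ⟨x⟩ : Nonempty I := inferInstance
  obtain ⟨y, hy⟩ : ∃ y, y = ν x := ⟨_, rfl⟩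
  obtain ⟨z, hz⟩ : ∃ z, z = ν y := ⟨_, rfl⟩
  have hxy : x ≠ y := hy ▸ (hne x).symm
  have hyz : y ≠ z := hz ▸ (hne y).symm
  have hxz : x ≠ z := by rw [hz, hy]; exact (hne2 x).symm
  have hx : ν z = x := by
    rcases eq_or_eq_or_eq_of_card_eq_three hcard hxy hxz hyz (ν z) with h | h | h
    · exact h
    · exact absurd (hz ▸ h) (hne2 y)
    · exact absurd h (hne z)
  have h02 := hg.2 z y
  have h10 := hg.2 x z
  have h21 := hg.2 y x
  rw [hx] at h02
  rw [← hy] at h10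
  rw [← hz] at h21
  have hpos := hbasic x y hxy
  obtain ⟨a, ha⟩ := Int.eq_ofNat_of_zero_le (hnn x y)
  obtain ⟨b, hb⟩ := Int.eq_ofNat_of_zero_le (hnn y z)
  obtain ⟨c, hc⟩ := Int.eq_ofNat_of_zero_le (hnn z x)
  refine ⟨Equiv.ofBijective _ (bijective_vec_of_card_eq_three hcard hxy hxz hyz),
    a, b, c, by omega, hqm.1 _, ha, ?_, ?_, hqm.1 _, hb, hc, ?_, hqm.1 _⟩ <;>
  · simp only [Equiv.ofBijective_apply, Matrix.cons_val]
    omega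
end

section
/- Let n ≥ 1 and let m₁, …, mₙ be nonnegative integers, not all zero, with indices read modulo n (so m₀ = mₙ). Define d on {1,…,n} (indices modulo n) by d(i,i) = 0, d(i,j) = m_i + m_{i+1} + ⋯ + m_{j−1} for i < j, and d(i,j) = m_i + ⋯ + mₙ + m₁ + ⋯ + m_{j−1} for i > j (the cyclic sum from i to j−1); this d is a nonnegative quasi-metric. Then for every i ∈ {1,…,n} and every integer j ≥ 1 with v_d(i,j) ∈ 𝕍_d, and for every y ∈ 𝕍_d with y < v_d(i,j) in the componentwise order, one has y ≤ v_d(i, j+1) or y ≤ v_d(i−1, j + m_{i−1}); in other words, v_d(i, j+1) and v_d(i−1, j + m_{i−1}) are the only possible maximal elements of the set of elements of 𝕍_d strictly below v_d(i,j). -/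
/-- The cyclic quasi-metric of `A(m₁,…,mₙ)`: `d i j` is the cyclic sum
`m_i + m_{i+1} + ⋯ + m_{j-1}` (indices modulo `n`), and `d i i = 0`. -/
def cycQM {n : ℕ} (m : Fin n → ℕ) (i j : Fin n) : ℤ :=
  ∑ t ∈ Finset.range ((j - i).val), (m ⟨(i.val + t) % n, Nat.mod_lt _ i.pos⟩ : ℤ)

theorem cycQM_nonneg {n : ℕ} (m : Fin n → ℕ) : IsNonnegQM (cycQM m) := fun _ _ =>
  Finset.sum_nonneg fun _ _ => Int.natCast_nonneg _

theorem cycQM_self {n : ℕ} (m : Fin n → ℕ) (i : Fin n) : cycQM m i i = 0 := by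
  have : NeZero n := ⟨i.pos.ne'⟩
  simp [cycQM]

theorem cycQM_triangle {n : ℕ} (m : Fin n → ℕ) (i j k : Fin n) :
    cycQM m i j ≤ cycQM m i k + cycQM m k j := by
  have : NeZero n := ⟨i.pos.ne'⟩
  have hlen : (j - i).val ≤ (k - i).val + (j - k).val := by
    have h : j - i = (k - i) + (j - k) := by abel
    rw [h, Fin.val_add]
    exact Nat.mod_le _ _
  have hk : k.val = (i.val + (k - i).val) % n := by
    rw [← Fin.val_add, add_sub_cancel]
  have hshift : cycQM m k j = ∑ t ∈ Finset.range (j - k).val,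
      (m ⟨(i.val + ((k - i).val + t)) % n, Nat.mod_lt _ i.pos⟩ : ℤ) := by
    refine Finset.sum_congr rfl fun t _ => ?_
    congr 3
    rw [hk, Nat.mod_add_mod, add_assoc]
  rw [hshift, cycQM, cycQM, ← Finset.sum_range_add]
  exact Finset.sum_le_sum_of_subset_of_nonneg (Finset.range_mono hlen)
    fun _ _ _ => Int.natCast_nonneg _

/-- Moving the endpoint one step back does not increase the cyclic sum, unless it passes the
starting point. -/
theorem cycQM_sub_one_le {n : ℕ} [NeZero n] (m : Fin n → ℕ) {a b : Fin n} (h : a ≠ b) :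
    cycQM m a (b - 1) ≤ cycQM m a b := by
  have hb : b - a ≠ 0 := sub_ne_zero.mpr h.symm
  have hval : (b - 1 - a).val ≤ (b - a).val := by
    rw [show b - 1 - a = b - a - 1 by abel, Fin.val_sub_one_of_ne_zero hb]
    exact Nat.sub_le _ _
  exact Finset.sum_le_sum_of_subset_of_nonneg (Finset.range_mono hval)
    fun _ _ _ => Int.natCast_nonneg _

/-- Moving the starting point one step back adds one term to the cyclic sum. -/
theorem cycQM_sub_one_left {n : ℕ} [NeZero n] (m : Fin n → ℕ) {i k : Fin n} (h : k ≠ i - 1) :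
    cycQM m (i - 1) k = cycQM m i k + m (i - 1) := by
  have hk : k - (i - 1) ≠ 0 := sub_ne_zero.mpr h
  have hn : 1 < n := by
    by_contra hn
    have : n = 1 := by have := NeZero.pos n; omega
    subst this
    exact h (Subsingleton.elim _ _)
  have hval : (k - (i - 1)).val = (k - i).val + 1 := by
    have h1 := Fin.val_sub_one_of_ne_zero hk
    rw [show k - (i - 1) - 1 = k - i by abel] at h1
    have : (k - (i - 1)).val ≠ 0 := fun h0 => hk (Fin.ext (by simpa using h0))
    omega
  have hi : i.val = ((i - 1).val + 1) % n := by
    conv_lhs => rw [← sub_add_cancel i 1, Fin.val_add, Fin.val_one', Nat.mod_eq_of_lt hn]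
  rw [cycQM, hval, Finset.sum_range_succ', cycQM]
  congr 1
  · refine Finset.sum_congr rfl fun t _ => ?_
    congr 3
    rw [hi, Nat.mod_add_mod, add_assoc, add_comm 1 t]
  · congr 2
    exact Fin.ext (Nat.mod_eq_of_lt (i - 1).isLt)

theorem vd_antitone {I : Type*} (d : I → I → ℤ) (i : I) : Antitone (vd d i) := by
  intro j j' h k
  simp only [vd]
  omega

/-- for the cyclic quasi-metric of `A(m₁,…,mₙ)` (a nonnegative
quasi-metric), the elements `v_d(i, j+1)` and `v_d(i-1, j+m_{i-1})` are the only
possible maximal elements of the set of elements of `𝕍_d` strictly below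
`v_d(i,j)`. -/
theorem stmt19 (n : ℕ) [NeZero n] (m : Fin n → ℕ) (hm : ∃ k, m k ≠ 0) :
    IsQM (cycQM m) ∧ IsNonnegQM (cycQM m) ∧
    ∀ i : Fin n, ∀ j : ℕ, 1 ≤ j → vd (cycQM m) i j ∈ Vd (cycQM m) →
      ∀ y ∈ Vd (cycQM m), y < vd (cycQM m) i j →
        y ≤ vd (cycQM m) i (j + 1) ∨ y ≤ vd (cycQM m) (i - 1) (j + m (i - 1)) := by
  refine ⟨⟨cycQM_self m, cycQM_triangle m⟩, cycQM_nonneg m, ?_⟩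
  rintro i j - - y ⟨⟨a, b, -, rfl⟩, -⟩ hlt
  by_cases ha : a = i
  · subst ha
    refine Or.inl (vd_antitone _ _ (Nat.succ_le_of_lt (lt_of_not_ge fun hb => ?_)))
    exact hlt.not_ge (vd_antitone _ _ hb)
  · refine Or.inr fun k => ?_
    by_cases hk : k = i - 1
    · have hi := hlt.le i
      have hmono := cycQM_sub_one_le m ha
      have hself := cycQM_self m i
      subst hk
      simp only [vd] at hi ⊢
      omega
    · have hle := hlt.le k
      have hshift := cycQM_sub_one_left m hk
      simp only [vd] at hle ⊢
      omega
end
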